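/- Every corner (extreme) point of the region 𝓡₁,SD(p) ∩ 𝓡₂,SD(p) is contained in at least one of the four regions 𝓡₁,SD ∩ 𝓡₂,SCD1→2, 𝓡₁,SD ∩ 𝓡₂,SCD2→1, 𝓡₁,SCD1→2 ∩ 𝓡₂,SD, and 𝓡₁,SCD2→1 ∩ 𝓡₂,SD. -/

import Mathlib

open scoped BigOperators Classical

noncomputable section

/-- Pushforward of a finitely supported weight function along a map. -/
def pushf {Ω β : Type*} [Fintype Ω] (q : Ω → ℝ) (f : Ω → β) : β → ℝ :=
  fun b => ∑ ω, if f ω = b then q ω else 0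

/-- Shannon entropy (in nats). -/
def ent {β : Type*} [Fintype β] (p : β → ℝ) : ℝ :=
  -∑ b, p b * Real.log (p b)

/-- Entropy of the random variable `A` under the joint pmf `q`. -/
def Hof {Ω β : Type*} [Fintype Ω] [Fintype β] (q : Ω → ℝ) (A : Ω → β) : ℝ :=
  ent (pushf q A)

/-- Mutual information `I(A;B)` under the joint pmf `q`. -/
def miOf {Ω α β : Type*} [Fintype Ω] [Fintype α] [Fintype β]
    (q : Ω → ℝ) (A : Ω → α) (B : Ω → β) : ℝ :=
  Hof q A + Hof q B - Hof q (fun ω => (A ω, B ω))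

/-- Conditional mutual information `I(A;B|C)` under the joint pmf `q`. -/
def cmiOf {Ω α β γ : Type*} [Fintype Ω] [Fintype α] [Fintype β] [Fintype γ]
    (q : Ω → ℝ) (A : Ω → α) (B : Ω → β) (C : Ω → γ) : ℝ :=
  Hof q (fun ω => (A ω, C ω)) + Hof q (fun ω => (B ω, C ω))
    - Hof q (fun ω => (A ω, B ω, C ω)) - Hof q C

/-- `p` is a probability mass function. -/
def IsPMF {α : Type*} [Fintype α] (p : α → ℝ) : Prop :=
  (∀ a, 0 ≤ p a) ∧ ∑ a, p a = 1

/-- Joint pmf on `(X, W, Y₁, Y₂)` induced by the product input pmf `pX · pW`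
and the interference channel `ch`. -/
def icJoint {𝒳 𝒲 𝒴₁ 𝒴₂ : Type} (pX : 𝒳 → ℝ) (pW : 𝒲 → ℝ)
    (ch : 𝒳 → 𝒲 → 𝒴₁ → 𝒴₂ → ℝ) : 𝒳 × 𝒲 × 𝒴₁ × 𝒴₂ → ℝ :=
  fun ω => pX ω.1 * pW ω.2.1 * ch ω.1 ω.2.1 ω.2.2.1 ω.2.2.2

variable {𝒳 𝒲 𝒴₁ 𝒴₂ : Type} [Fintype 𝒳] [Fintype 𝒲] [Fintype 𝒴₁] [Fintype 𝒴₂]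

/-- `𝓡₁,SD(p)`: `R₁ ≤ I(X;Y₁|W)`, `R₂ ≤ I(W;Y₁|X)`, `R₁+R₂ ≤ I(X,W;Y₁)`. -/
def R1SD (pX : 𝒳 → ℝ) (pW : 𝒲 → ℝ) (ch : 𝒳 → 𝒲 → 𝒴₁ → 𝒴₂ → ℝ) : Set (ℝ × ℝ) :=
  {R | 0 ≤ R.1 ∧ 0 ≤ R.2 ∧
    R.1 ≤ cmiOf (icJoint pX pW ch) (fun ω => ω.1) (fun ω => ω.2.2.1) (fun ω => ω.2.1) ∧
    R.2 ≤ cmiOf (icJoint pX pW ch) (fun ω => ω.2.1) (fun ω => ω.2.2.1) (fun ω => ω.1) ∧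
    R.1 + R.2 ≤ miOf (icJoint pX pW ch) (fun ω => (ω.1, ω.2.1)) (fun ω => ω.2.2.1)}

/-- `𝓡₂,SD(p)`: `R₂ ≤ I(W;Y₂|X)`, `R₁ ≤ I(X;Y₂|W)`, `R₁+R₂ ≤ I(X,W;Y₂)`. -/
def R2SD (pX : 𝒳 → ℝ) (pW : 𝒲 → ℝ) (ch : 𝒳 → 𝒲 → 𝒴₁ → 𝒴₂ → ℝ) : Set (ℝ × ℝ) :=
  {R | 0 ≤ R.1 ∧ 0 ≤ R.2 ∧
    R.1 ≤ cmiOf (icJoint pX pW ch) (fun ω => ω.1) (fun ω => ω.2.2.2) (fun ω => ω.2.1) ∧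
    R.2 ≤ cmiOf (icJoint pX pW ch) (fun ω => ω.2.1) (fun ω => ω.2.2.2) (fun ω => ω.1) ∧
    R.1 + R.2 ≤ miOf (icJoint pX pW ch) (fun ω => (ω.1, ω.2.1)) (fun ω => ω.2.2.2)}

/-- `𝓡₁,SCD1→2`: `R₁ ≤ I(X;Y₁)`, `R₂ ≤ I(W;Y₁|X)`. -/
def R1SCD12 (pX : 𝒳 → ℝ) (pW : 𝒲 → ℝ) (ch : 𝒳 → 𝒲 → 𝒴₁ → 𝒴₂ → ℝ) : Set (ℝ × ℝ) :=
  {R | 0 ≤ R.1 ∧ 0 ≤ R.2 ∧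
    R.1 ≤ miOf (icJoint pX pW ch) (fun ω => ω.1) (fun ω => ω.2.2.1) ∧
    R.2 ≤ cmiOf (icJoint pX pW ch) (fun ω => ω.2.1) (fun ω => ω.2.2.1) (fun ω => ω.1)}

/-- `𝓡₁,SCD2→1`: `R₁ ≤ I(X;Y₁|W)`, `R₂ ≤ I(W;Y₁)`. -/
def R1SCD21 (pX : 𝒳 → ℝ) (pW : 𝒲 → ℝ) (ch : 𝒳 → 𝒲 → 𝒴₁ → 𝒴₂ → ℝ) : Set (ℝ × ℝ) :=
  {R | 0 ≤ R.1 ∧ 0 ≤ R.2 ∧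
    R.1 ≤ cmiOf (icJoint pX pW ch) (fun ω => ω.1) (fun ω => ω.2.2.1) (fun ω => ω.2.1) ∧
    R.2 ≤ miOf (icJoint pX pW ch) (fun ω => ω.2.1) (fun ω => ω.2.2.1)}

/-- `𝓡₂,SCD1→2`: `R₁ ≤ I(X;Y₂)`, `R₂ ≤ I(W;Y₂|X)`. -/
def R2SCD12 (pX : 𝒳 → ℝ) (pW : 𝒲 → ℝ) (ch : 𝒳 → 𝒲 → 𝒴₁ → 𝒴₂ → ℝ) : Set (ℝ × ℝ) :=
  {R | 0 ≤ R.1 ∧ 0 ≤ R.2 ∧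
    R.1 ≤ miOf (icJoint pX pW ch) (fun ω => ω.1) (fun ω => ω.2.2.2) ∧
    R.2 ≤ cmiOf (icJoint pX pW ch) (fun ω => ω.2.1) (fun ω => ω.2.2.2) (fun ω => ω.1)}

/-- `𝓡₂,SCD2→1`: `R₁ ≤ I(X;Y₂|W)`, `R₂ ≤ I(W;Y₂)`. -/
def R2SCD21 (pX : 𝒳 → ℝ) (pW : 𝒲 → ℝ) (ch : 𝒳 → 𝒲 → 𝒴₁ → 𝒴₂ → ℝ) : Set (ℝ × ℝ) :=
  {R | 0 ≤ R.1 ∧ 0 ≤ R.2 ∧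
    R.1 ≤ cmiOf (icJoint pX pW ch) (fun ω => ω.1) (fun ω => ω.2.2.2) (fun ω => ω.2.1) ∧
    R.2 ≤ miOf (icJoint pX pW ch) (fun ω => ω.2.1) (fun ω => ω.2.2.2)}

section Entropy

variable {Ω α β : Type*} [Fintype Ω]

lemma Hof_equiv_comp [Fintype α] [Fintype β] (q : Ω → ℝ) (e : α ≃ β) (A : Ω → α) :
    Hof q (fun ω => e (A ω)) = Hof q A := by
  unfold Hof ent
  congr 1
  rw [← e.sum_comp]
  simp [pushf]

lemma pushf_nonneg {q : Ω → ℝ} (hq : ∀ ω, 0 ≤ q ω) (A : Ω → α) (a : α) : 0 ≤ pushf q A a :=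
  Finset.sum_nonneg fun ω _ => by split_ifs <;> simp [hq]

lemma sum_pushf [Fintype α] (q : Ω → ℝ) (A : Ω → α) : ∑ a, pushf q A a = ∑ ω, q ω := by
  unfold pushf
  rw [Finset.sum_comm]
  simp

lemma sum_pushf_prod_right [Fintype β] (q : Ω → ℝ) (A : Ω → α) (B : Ω → β) (a : α) :
    ∑ b, pushf q (fun ω => (A ω, B ω)) (a, b) = pushf q A a := by
  unfold pushf
  rw [Finset.sum_comm]
  refine Finset.sum_congr rfl fun ω _ => ?_
  by_cases h : A ω = a <;> simp [Prod.ext_iff, h]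

lemma sum_pushf_prod_left [Fintype α] (q : Ω → ℝ) (A : Ω → α) (B : Ω → β) (b : β) :
    ∑ a, pushf q (fun ω => (A ω, B ω)) (a, b) = pushf q B b := by
  unfold pushf
  rw [Finset.sum_comm]
  refine Finset.sum_congr rfl fun ω _ => ?_
  by_cases h : B ω = b <;> simp [Prod.ext_iff, h]

lemma sub_mul_le_mul_log {p a b : ℝ} (hp : 0 ≤ p) (hpa : p ≤ a) (hpb : p ≤ b) :
    p - a * b ≤ p * Real.log p - p * Real.log a - p * Real.log b := by
  rcases hp.eq_or_lt with rfl | hp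
  · simpa using mul_nonneg hpa hpb
  · have ha := hp.trans_le hpa
    have hb := hp.trans_le hpb
    have h := mul_le_mul_of_nonneg_left
      (Real.log_le_sub_one_of_pos (show 0 < a * b / p by positivity)) hp.le
    rw [Real.log_div (by positivity) hp.ne', Real.log_mul ha.ne' hb.ne', mul_sub, mul_sub, mul_one,
      mul_div_cancel₀ _ hp.ne', mul_add] at h
    linarith

variable [Fintype α] [Fintype β]

lemma miOf_nonneg {q : Ω → ℝ} (hq : IsPMF q) (A : Ω → α) (B : Ω → β) : 0 ≤ miOf q A B := by
  set p := pushf q fun ω => (A ω, B ω) with hp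
  have hp0 : ∀ c, 0 ≤ p c := pushf_nonneg hq.1 _
  have hA : ∀ a, ∑ b, p (a, b) = pushf q A a := sum_pushf_prod_right q A B
  have hB : ∀ b, ∑ a, p (a, b) = pushf q B b := sum_pushf_prod_left q A B
  have hpA : ∀ a b, p (a, b) ≤ pushf q A a := fun a b => by
    rw [← hA]
    exact Finset.single_le_sum (f := fun b => p (a, b)) (fun _ _ => hp0 _) (Finset.mem_univ b)
  have hpB : ∀ a b, p (a, b) ≤ pushf q B b := fun a b => by
    rw [← hB]
    exact Finset.single_le_sum (f := fun a => p (a, b)) (fun _ _ => hp0 _) (Finset.mem_univ a)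
  have hsum : ∑ a, ∑ b, (p (a, b) - pushf q A a * pushf q B b) = 0 := by
    simp only [Finset.sum_sub_distrib, ← Finset.mul_sum, sum_pushf, hA, hq.2, mul_one, sub_self,
      Finset.sum_const_zero]
  have hentA : ∑ a, ∑ b, p (a, b) * Real.log (pushf q A a) =
      ∑ a, pushf q A a * Real.log (pushf q A a) := by
    simp only [← Finset.sum_mul, hA]
  have hentB : ∑ a, ∑ b, p (a, b) * Real.log (pushf q B b) =
      ∑ b, pushf q B b * Real.log (pushf q B b) := by
    rw [Finset.sum_comm]
    simp only [← Finset.sum_mul, hB]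
  have hle := Finset.sum_le_sum fun a (_ : a ∈ Finset.univ) =>
    Finset.sum_le_sum fun b (_ : b ∈ Finset.univ) =>
      sub_mul_le_mul_log (hp0 (a, b)) (hpA a b) (hpB a b)
  rw [hsum] at hle
  simp only [Finset.sum_sub_distrib, hentA, hentB] at hle
  simp only [miOf, Hof, ent, ← hp, Fintype.sum_prod_type]
  linarith

variable {γ : Type*} [Fintype γ]

/-- Chain rule `I(A,B;C) = I(A;C) + I(B;C|A)`. -/
lemma miOf_prod_eq_add_cmiOf (q : Ω → ℝ) (A : Ω → α) (B : Ω → β) (C : Ω → γ) :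
    miOf q (fun ω => (A ω, B ω)) C = miOf q A C + cmiOf q B C A := by
  have h₁ := Hof_equiv_comp q (Equiv.prodComm α β) fun ω => (A ω, B ω)
  have h₂ := Hof_equiv_comp q (Equiv.prodComm α γ) fun ω => (A ω, C ω)
  have h₃ := Hof_equiv_comp q
    ((Equiv.prodAssoc α β γ).trans ((Equiv.prodComm α (β × γ)).trans (Equiv.prodAssoc β γ α)))
    fun ω => ((A ω, B ω), C ω)
  simp only [Equiv.trans_apply, Equiv.prodComm_apply, Equiv.prodAssoc_apply, Prod.swap] at h₁ h₂ h₃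
  unfold miOf cmiOf
  linarith

lemma miOf_prod_swap (q : Ω → ℝ) (A : Ω → α) (B : Ω → β) (C : Ω → γ) :
    miOf q (fun ω => (A ω, B ω)) C = miOf q (fun ω => (B ω, A ω)) C := by
  have h₁ := Hof_equiv_comp q (Equiv.prodComm α β) fun ω => (A ω, B ω)
  have h₂ := Hof_equiv_comp q ((Equiv.prodComm α β).prodCongr (Equiv.refl γ))
    fun ω => ((A ω, B ω), C ω)
  simp only [Equiv.prodComm_apply, Equiv.prodCongr_apply, Prod.map, Equiv.refl_apply,
    Prod.swap] at h₁ h₂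
  unfold miOf
  linarith

end Entropy

lemma isPMF_icJoint {pX : 𝒳 → ℝ} {pW : 𝒲 → ℝ} {ch : 𝒳 → 𝒲 → 𝒴₁ → 𝒴₂ → ℝ}
    (hpX : IsPMF pX) (hpW : IsPMF pW) (hch0 : ∀ x w y₁ y₂, 0 ≤ ch x w y₁ y₂)
    (hch1 : ∀ x w, ∑ y₁, ∑ y₂, ch x w y₁ y₂ = 1) : IsPMF (icJoint pX pW ch) := by
  refine ⟨fun ω => mul_nonneg (mul_nonneg (hpX.1 _) (hpW.1 _)) (hch0 _ _ _ _), ?_⟩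
  simp only [icJoint, Fintype.sum_prod_type, ← Finset.mul_sum, hch1, mul_one, hpW.2, hpX.2]

/-- A point of a set at which a small move in both directions along a fixed nonzero vector
stays in the set is not an extreme point. -/
lemma notMem_extremePoints_of_add_sub_mem {E : Type*} [AddCommGroup E] [Module ℝ E] {s : Set E}
    {x v : E} (hv : v ≠ 0) (hadd : x + v ∈ s) (hsub : x - v ∈ s) : x ∉ s.extremePoints ℝ := by
  intro hx
  have hmem : x ∈ openSegment ℝ (x + v) (x - v) :=
    ⟨1 / 2, 1 / 2, by norm_num, by norm_num, by norm_num, by module⟩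
  exact hv (by simpa using hx.2 hadd hsub hmem)

/-- Every corner (extreme) point of `𝓡₁,SD ∩ 𝓡₂,SD` lies in one of the four regions
`𝓡₁,SD ∩ 𝓡₂,SCD1→2`, `𝓡₁,SD ∩ 𝓡₂,SCD2→1`, `𝓡₁,SCD1→2 ∩ 𝓡₂,SD`, `𝓡₁,SCD2→1 ∩ 𝓡₂,SD`. -/
theorem corner_points_covered
    (pX : 𝒳 → ℝ) (pW : 𝒲 → ℝ) (ch : 𝒳 → 𝒲 → 𝒴₁ → 𝒴₂ → ℝ)
    (hpX : IsPMF pX) (hpW : IsPMF pW)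
    (hch0 : ∀ x w y₁ y₂, 0 ≤ ch x w y₁ y₂)
    (hch1 : ∀ x w, ∑ y₁, ∑ y₂, ch x w y₁ y₂ = 1) :
    ∀ R ∈ Set.extremePoints ℝ (R1SD pX pW ch ∩ R2SD pX pW ch),
      R ∈ (R1SD pX pW ch ∩ R2SCD12 pX pW ch) ∪ (R1SD pX pW ch ∩ R2SCD21 pX pW ch) ∪
          (R1SCD12 pX pW ch ∩ R2SD pX pW ch) ∪ (R1SCD21 pX pW ch ∩ R2SD pX pW ch) := by
  intro R hR
  have hq := isPMF_icJoint hpX hpW hch0 hch1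
  have hX := miOf_nonneg hq (fun ω => ω.1) (fun ω => ω.2.2.1)
  have hW := miOf_nonneg hq (fun ω => ω.2.1) (fun ω => ω.2.2.1)
  have hX₁ := miOf_prod_eq_add_cmiOf (icJoint pX pW ch)
    (fun ω => ω.1) (fun ω => ω.2.1) (fun ω => ω.2.2.1)
  have hX₂ := miOf_prod_eq_add_cmiOf (icJoint pX pW ch)
    (fun ω => ω.1) (fun ω => ω.2.1) (fun ω => ω.2.2.2)
  have hW₁ := miOf_prod_eq_add_cmiOf (icJoint pX pW ch)
    (fun ω => ω.2.1) (fun ω => ω.1) (fun ω => ω.2.2.1)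
  have hW₂ := miOf_prod_eq_add_cmiOf (icJoint pX pW ch)
    (fun ω => ω.2.1) (fun ω => ω.1) (fun ω => ω.2.2.2)
  rw [← miOf_prod_swap] at hW₁ hW₂
  have hmem := hR.1
  by_contra hnot
  simp only [R1SD, R2SD, R1SCD12, R1SCD21, R2SCD12, R2SCD21, Set.mem_union, Set.mem_inter_iff,
    Set.mem_ofPred_eq] at hmem hnot
  obtain ⟨⟨h0, h0', ha₁, hb₁, hs₁⟩, -, -, ha₂, hb₂, hs₂⟩ := hmem
  simp only [h0, h0', ha₁, hb₁, hs₁, ha₂, hb₂, hs₂, true_and, and_true, not_or, not_le] at hnot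
  obtain ⟨⟨⟨hX₂', hW₂'⟩, hX₁'⟩, hW₁'⟩ := hnot
  set a₁ := cmiOf (icJoint pX pW ch) (fun ω => ω.1) (fun ω => ω.2.2.1) (fun ω => ω.2.1)
  set b₁ := cmiOf (icJoint pX pW ch) (fun ω => ω.2.1) (fun ω => ω.2.2.1) (fun ω => ω.1)
  set a₂ := cmiOf (icJoint pX pW ch) (fun ω => ω.1) (fun ω => ω.2.2.2) (fun ω => ω.2.1)
  set b₂ := cmiOf (icJoint pX pW ch) (fun ω => ω.2.1) (fun ω => ω.2.2.2) (fun ω => ω.1)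
  obtain ⟨ε, hε, hlt⟩ : ∃ ε > 0, ε < min (min R.1 R.2)
      (min (min (a₁ - R.1) (b₁ - R.2)) (min (a₂ - R.1) (b₂ - R.2))) := by
    refine exists_between ?_
    simp only [lt_min_iff]
    refine ⟨⟨?_, ?_⟩, ⟨?_, ?_⟩, ?_, ?_⟩ <;> linarith
  simp only [lt_min_iff] at hlt
  obtain ⟨⟨hε₁, hε₂⟩, ⟨hε₃, hε₄⟩, hε₅, hε₆⟩ := hlt
  refine notMem_extremePoints_of_add_sub_mem (v := (ε, -ε)) (by simp [hε.ne']) ?_ ?_ hR <;>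
  · simp only [R1SD, R2SD, Set.mem_inter_iff, Set.mem_ofPred_eq, Prod.fst_add, Prod.snd_add,
      Prod.fst_sub, Prod.snd_sub]
    refine ⟨⟨?_, ?_, ?_, ?_, ?_⟩, ?_, ?_, ?_, ?_, ?_⟩ <;> linarith
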